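/- arXiv:2511.00835 — 8 statements merged into one kernel-verified Lean document; each statement's English description precedes it below -/
import Mathlib

section
/- Let χ be a stable allocation (a max-USW allocation admitting no narrowing transfer). Then χ is LexiMin-optimal: for every max-USW allocation χ', the profile of χ sorted in ascending order is greater than or equal to the profile of χ' sorted in ascending order, in the lexicographic order. -/
open Finset

/-- `χ` is a (partial) allocation of `m` indivisible items to `n` agents respecting `likes`:
whenever item `o` is assigned to agent `j`, agent `j` likes item `o`. -/
def IsAlloc {m n : ℕ} (likes : Fin n → Fin m → Prop) (χ : Fin m → Option (Fin n)) : Prop :=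
  ∀ o j, χ o = some j → likes j o

/-- The profile of an allocation: agent `j` receives `prof χ j` items. -/
def prof {m n : ℕ} (χ : Fin m → Option (Fin n)) (j : Fin n) : ℕ :=
  (Finset.univ.filter fun o => χ o = some j).card

/-- Utilitarian social welfare: the total number of allocated items. -/
def usw {m n : ℕ} (χ : Fin m → Option (Fin n)) : ℕ := ∑ j, prof χ j

/-- A max-USW allocation. -/
def MaxUSW {m n : ℕ} (likes : Fin n → Fin m → Prop) (χ : Fin m → Option (Fin n)) : Prop :=
  IsAlloc likes χ ∧ ∀ χ', IsAlloc likes χ' → usw χ' ≤ usw χ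

/-- A transfer path in `χ` from agent `u` to agent `v`: pairwise distinct agents
`a 0 = u, …, a k = v` (`k ≥ 1`) and items `o 0, …, o (k-1)` with `χ` assigning `o t` to
`a t` and agent `a (t+1)` liking `o t`. -/
def TransferPath {m n : ℕ} (likes : Fin n → Fin m → Prop) (χ : Fin m → Option (Fin n))
    (u v : Fin n) : Prop :=
  ∃ k : ℕ, 1 ≤ k ∧ ∃ a : Fin (k + 1) → Fin n, Function.Injective a ∧
    a 0 = u ∧ a (Fin.last k) = v ∧
    ∃ o : Fin k → Fin m, ∀ t : Fin k,
      χ (o t) = some (a t.castSucc) ∧ likes (a t.succ) (o t)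

/-- `χ` admits a narrowing transfer: a transfer path from `u` to `v` with `h_u ≥ h_v + 2`. -/
def Narrowing {m n : ℕ} (likes : Fin n → Fin m → Prop) (χ : Fin m → Option (Fin n)) : Prop :=
  ∃ u v, TransferPath likes χ u v ∧ prof χ v + 2 ≤ prof χ u

/-- A stable allocation: max-USW and admitting no narrowing transfer. -/
def Stable {m n : ℕ} (likes : Fin n → Fin m → Prop) (χ : Fin m → Option (Fin n)) : Prop :=
  MaxUSW likes χ ∧ ¬ Narrowing likes χ

/-- The profile of `χ` sorted in ascending order. -/
noncomputable def sortedProf {m n : ℕ} (χ : Fin m → Option (Fin n)) : Fin n → ℕ :=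
  prof χ ∘ Tuple.sort (prof χ)

/-- Vertices joined by a chain of a relation are joined by a chain without repetitions. -/
theorem exists_injOn_chain_of_reflTransGen {α : Type*} {r : α → α → Prop} {u v : α}
    (h : Relation.ReflTransGen r u v) :
    ∃ (k : ℕ) (a : ℕ → α), Set.InjOn a (Set.Iic k) ∧ a 0 = u ∧ a k = v ∧
      ∀ t < k, r (a t) (a (t + 1)) := by
  induction h using Relation.ReflTransGen.head_induction_on with
  | refl => exact ⟨0, fun _ => v, by intro i hi j hj _; simp_all, rfl, rfl, by simp⟩
  | @head w x hwx _ ih =>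
    obtain ⟨k, a, ha, h0, hk, hr⟩ := ih
    by_cases hw : ∃ i ≤ k, a i = w
    · obtain ⟨i, hi, hiw⟩ := hw
      refine ⟨k - i, fun t => a (i + t), ?_, hiw, ?_, fun t ht => hr (i + t) (by omega)⟩
      · intro s hs t ht hst
        simp only [Set.mem_Iic] at hs ht
        have := ha (Set.mem_Iic.2 (by omega)) (Set.mem_Iic.2 (by omega)) hst
        omega
      · simpa only [Nat.add_sub_cancel' hi] using hk
    · push Not at hw
      refine ⟨k + 1, fun t => Nat.casesOn t w a, ?_, rfl, hk, ?_⟩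
      · rintro (_ | s) hs (_ | t) ht hst
        · rfl
        · exact absurd hst.symm (hw t (by simpa using ht))
        · exact absurd hst (hw s (by simpa using hs))
        · rw [ha (by simpa using hs) (by simpa using ht) hst]
      · rintro (_ | t) ht
        · change r w (a 0)
          rwa [h0]
        · exact hr t (by omega)

/-- `TransferEdge likes χ u v` says that `u` owns an item liked by `v`. -/
def TransferEdge {m n : ℕ} (likes : Fin n → Fin m → Prop) (χ : Fin m → Option (Fin n))
    (u v : Fin n) : Prop :=
  ∃ o, χ o = some u ∧ likes v o

theorem transferPath_of_reflTransGen {m n : ℕ} {likes : Fin n → Fin m → Prop}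
    {χ : Fin m → Option (Fin n)} {u v : Fin n} (huv : u ≠ v)
    (h : Relation.ReflTransGen (TransferEdge likes χ) u v) : TransferPath likes χ u v := by
  obtain ⟨k, a, ha, h0, hk, hr⟩ := exists_injOn_chain_of_reflTransGen h
  have hk1 : 1 ≤ k := by
    rcases Nat.eq_zero_or_pos k with rfl | hpos
    · exact absurd (h0.symm.trans hk) huv
    · exact hpos
  choose o ho using fun t : Fin k => hr t t.2
  refine ⟨k, hk1, fun t => a t, fun s t hst => ?_, h0, by simpa using hk, o, fun t => ?_⟩
  · exact Fin.ext (ha (Set.mem_Iic.2 (Nat.le_of_lt_succ s.2))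
      (Set.mem_Iic.2 (Nat.le_of_lt_succ t.2)) hst)
  · simpa using ho t

theorem sum_prof_eq_card {m n : ℕ} (χ : Fin m → Option (Fin n)) (R : Finset (Fin n)) :
    ∑ j ∈ R, prof χ j = (univ.filter fun o => ∃ j ∈ R, χ o = some j).card := by
  classical
  have : (univ.filter fun o => ∃ j ∈ R, χ o = some j) =
      R.biUnion fun j => univ.filter fun o => χ o = some j := by
    ext o; simp
  rw [this, card_biUnion]
  · rfl
  · intro i _ j _ hij
    rw [Function.onFun, disjoint_left]
    intro o hi hj
    simp only [mem_filter, mem_univ, true_and] at hi hj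
    exact hij (Option.some.inj (hi.symm.trans hj))

/-- In a max-USW allocation every liked item is allocated. -/
theorem MaxUSW.exists_eq_some {m n : ℕ} {likes : Fin n → Fin m → Prop}
    {χ : Fin m → Option (Fin n)} (hχ : MaxUSW likes χ) {j : Fin n} {o : Fin m}
    (hj : likes j o) : ∃ i, χ o = some i := by
  classical
  by_contra! hno
  have halloc : IsAlloc likes (Function.update χ o (some j)) := by
    intro p i hp
    rcases eq_or_ne p o with rfl | hpo
    · rw [Function.update_self] at hp
      exact Option.some.inj hp ▸ hj
    · rw [Function.update_of_ne hpo] at hp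
      exact hχ.1 p i hp
  refine (hχ.2 _ halloc).not_gt ?_
  unfold usw
  rw [sum_prof_eq_card, sum_prof_eq_card]
  refine card_lt_card (ssubset_iff_of_subset ?_ |>.2 ⟨o, ?_, ?_⟩)
  · intro p hp
    simp only [mem_filter, mem_univ, true_and] at hp ⊢
    obtain ⟨i, hi⟩ := hp
    have hpo : p ≠ o := by rintro rfl; exact hno i hi
    exact ⟨i, by rwa [Function.update_of_ne hpo]⟩
  · simp
  · simpa using hno

/-- A stable allocation maximizes every truncated welfare `∑ j, min (prof χ j) t`. -/
theorem Stable.sum_min_prof_le {m n : ℕ} {likes : Fin n → Fin m → Prop}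
    {χ : Fin m → Option (Fin n)} (hχ : Stable likes χ)
    {χ' : Fin m → Option (Fin n)} (hχ' : IsAlloc likes χ') (t : ℕ) :
    ∑ j, min (prof χ' j) t ≤ ∑ j, min (prof χ j) t := by
  classical
  -- the agents from which an agent owning fewer than `t` items can be reached
  set R : Finset (Fin n) := univ.filter fun j =>
    ∃ v, prof χ v < t ∧ Relation.ReflTransGen (TransferEdge likes χ) j v with hR
  have hin : ∀ j ∈ R, prof χ j ≤ t := by
    intro j hj
    obtain ⟨v, hv, hjv⟩ := (mem_filter.1 hj).2
    by_contra! hlt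
    have hne : j ≠ v := by rintro rfl; omega
    exact hχ.2 ⟨j, v, transferPath_of_reflTransGen hne hjv, by omega⟩
  have hout : ∀ j ∈ Rᶜ, t ≤ prof χ j := by
    intro j hj
    by_contra! hlt
    exact mem_compl.1 hj (mem_filter.2 ⟨mem_univ j, j, hlt, .refl⟩)
  have hsum : ∑ j ∈ R, prof χ' j ≤ ∑ j ∈ R, prof χ j := by
    rw [sum_prof_eq_card, sum_prof_eq_card]
    refine card_le_card fun o ho => ?_
    simp only [mem_filter, mem_univ, true_and] at ho ⊢
    obtain ⟨j, hj, hoj⟩ := ho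
    have hlike := hχ' o j hoj
    obtain ⟨i, hi⟩ := hχ.1.exists_eq_some hlike
    obtain ⟨v, hv, hjv⟩ := (mem_filter.1 hj).2
    exact ⟨i, mem_filter.2 ⟨mem_univ i, v, hv, .head ⟨o, hi, hlike⟩ hjv⟩, hi⟩
  rw [← sum_add_sum_compl R, ← sum_add_sum_compl R fun j => min (prof χ j) t]
  refine add_le_add ?_ (sum_le_sum fun j hj => ?_)
  · calc ∑ j ∈ R, min (prof χ' j) t ≤ ∑ j ∈ R, prof χ' j := sum_le_sum fun _ _ => min_le_left _ _
      _ ≤ ∑ j ∈ R, prof χ j := hsum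
      _ = ∑ j ∈ R, min (prof χ j) t := sum_congr rfl fun j hj => (min_eq_left (hin j hj)).symm
  · rw [min_eq_right (hout j hj)]
    exact min_le_right _ _

theorem toLex_le_of_sum_min_le {n : ℕ} {f g : Fin n → ℕ} (hf : Monotone f)
    (h : ∀ t, ∑ i, min (f i) t ≤ ∑ i, min (g i) t) : toLex f ≤ toLex g := by
  by_contra! hlt
  obtain ⟨i, heq, hi⟩ := hlt
  replace heq : ∀ j < i, g j = f j := heq
  replace hi : g i < f i := hi
  refine (h (g i + 1)).not_gt (sum_lt_sum (fun j _ => ?_) ⟨i, mem_univ i, by omega⟩)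
  rcases lt_or_ge j i with hj | hj
  · rw [heq j hj]
  · have := hf hj
    omega

/-- a stable allocation is LexiMin-optimal: its ascending-sorted profile is
lexicographically greater than or equal to that of any max-USW allocation. -/
theorem stable_lexiMin_optimal {m n : ℕ} (likes : Fin n → Fin m → Prop)
    (χ : Fin m → Option (Fin n)) (hχ : Stable likes χ)
    (χ' : Fin m → Option (Fin n)) (hχ' : MaxUSW likes χ') :
    toLex (sortedProf χ') ≤ toLex (sortedProf χ) := by
  refine toLex_le_of_sum_min_le (Tuple.monotone_sort _) fun t => ?_
  have hsort : ∀ ψ : Fin m → Option (Fin n),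
      ∑ i, min (sortedProf ψ i) t = ∑ j, min (prof ψ j) t := fun ψ =>
    Equiv.sum_comp (Tuple.sort (prof ψ)) fun j => min (prof ψ j) t
  rw [hsort, hsort]
  exact hχ.sum_min_prof_le hχ'.1 t
end

section
/- For every instance (any relation 'agent j likes item o' between m items and n agents), there exists a stable allocation, i.e. a max-USW allocation admitting no narrowing transfer. -/
open Finset

lemma prof_eq_ite_add {m n : ℕ} (χ : Fin m → Option (Fin n)) (o : Fin m) (j : Fin n) :
    prof χ j = (if χ o = some j then 1 else 0)
      + ∑ i ∈ univ.erase o, if χ i = some j then 1 else 0 := by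
  rw [prof, card_filter, add_sum_erase _ (fun i => if χ i = some j then 1 else 0) (mem_univ o)]

/-- Handing item `o` from agent `u` to agent `v` moves one unit of the profile. -/
lemma prof_update {m n : ℕ} {χ : Fin m → Option (Fin n)} {o : Fin m} {u : Fin n}
    (hu : χ o = some u) (v j : Fin n) :
    prof (Function.update χ o (some v)) j + (if j = u then 1 else 0)
      = prof χ j + (if j = v then 1 else 0) := by
  have hrest : (∑ i ∈ univ.erase o, if Function.update χ o (some v) i = some j then 1 else 0)
      = ∑ i ∈ univ.erase o, if χ i = some j then 1 else 0 :=
    sum_congr rfl fun i hi => by rw [Function.update_of_ne (ne_of_mem_erase hi)]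
  rw [prof_eq_ite_add _ o, prof_eq_ite_add χ o, hrest, Function.update_self, hu]
  simp only [Option.some.injEq, eq_comm (a := j)]
  omega

/-- Executing a transfer path moves one unit of the profile from its start to its end. -/
lemma exists_alloc_of_path {m n : ℕ} {likes : Fin n → Fin m → Prop} (k : ℕ)
    {χ : Fin m → Option (Fin n)} (hχ : IsAlloc likes χ) (a : Fin (k + 1) → Fin n)
    (ha : Function.Injective a) (o : Fin k → Fin m)
    (ho : ∀ t : Fin k, χ (o t) = some (a t.castSucc) ∧ likes (a t.succ) (o t)) :
    ∃ χ', IsAlloc likes χ' ∧ ∀ j,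
      prof χ' j + (if j = a 0 then 1 else 0)
        = prof χ j + (if j = a (Fin.last k) then 1 else 0) := by
  induction k generalizing χ with
  | zero => exact ⟨χ, hχ, fun j => rfl⟩
  | succ k ih =>
    have halloc : IsAlloc likes (Function.update χ (o 0) (some (a 1))) := by
      intro i j hij
      by_cases hi : i = o 0
      · subst hi
        rw [Function.update_self, Option.some.injEq] at hij
        exact hij ▸ (ho 0).2
      · rw [Function.update_of_ne hi] at hij
        exact hχ i j hij
    obtain ⟨χ', hχ', hprof⟩ := ih halloc (fun t => a t.succ)
      (ha.comp (Fin.succ_injective _)) (fun t => o t.succ) (fun t => by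
        refine ⟨?_, (ho t.succ).2⟩
        have hne : o t.succ ≠ o 0 := by
          intro h
          have h0 := (ho t.succ).1
          rw [h, (ho 0).1, Option.some.injEq] at h0
          exact absurd (ha h0) (by simp [Fin.ext_iff])
        rw [Function.update_of_ne hne, (ho t.succ).1]
        rfl)
    refine ⟨χ', hχ', fun j => ?_⟩
    have htail : prof χ' j + (if j = a 1 then 1 else 0)
        = prof (Function.update χ (o 0) (some (a 1))) j
          + (if j = a (Fin.last (k + 1)) then 1 else 0) := hprof j
    have hhead : prof (Function.update χ (o 0) (some (a 1))) j + (if j = a 0 then 1 else 0)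
        = prof χ j + (if j = a 1 then 1 else 0) := prof_update (ho 0).1 (a 1) j
    omega

lemma sum_eq_of_move {ι : Type*} [Fintype ι] [DecidableEq ι] {h h' : ι → ℕ} {u v : ι}
    (hm : ∀ j, h' j + (if j = u then 1 else 0) = h j + (if j = v then 1 else 0)) :
    ∑ j, h' j = ∑ j, h j := by
  have := sum_congr (rfl : (univ : Finset ι) = univ) fun j _ => hm j
  simpa [sum_add_distrib] using this

/-- A Robin Hood move strictly decreases the sum of squares. -/
lemma sum_sq_lt_of_move {ι : Type*} [Fintype ι] [DecidableEq ι] {h h' : ι → ℕ} {u v : ι}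
    (hm : ∀ j, h' j + (if j = u then 1 else 0) = h j + (if j = v then 1 else 0))
    (huv : h v + 2 ≤ h u) :
    ∑ j, h' j ^ 2 < ∑ j, h j ^ 2 := by
  have hne : u ≠ v := by rintro rfl; omega
  have hu : h' u + 1 = h u := by simpa [hne] using hm u
  have hpt : ∀ j, h' j ^ 2 + (if j = u then 2 * h' u + 1 else 0)
      = h j ^ 2 + (if j = v then 2 * h v + 1 else 0) := by
    intro j
    have hj := hm j
    by_cases hju : j = u
    · subst hju
      simp only [hne, if_true, if_false, ← hu]
      ring
    · by_cases hjv : j = v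
      · subst hjv
        simp only [hju, if_true, if_false, add_zero] at hj ⊢
        rw [hj]
        ring
      · simpa [hju, hjv] using hj
  have hsum := sum_congr (rfl : (univ : Finset ι) = univ) fun j _ => hpt j
  simp only [sum_add_distrib, sum_ite_eq', mem_univ, if_true] at hsum
  omega

/-- for every instance, a stable allocation exists. -/
theorem stable_alloc_exists {m n : ℕ} (likes : Fin n → Fin m → Prop) :
    ∃ χ : Fin m → Option (Fin n), Stable likes χ := by
  obtain ⟨χ₀, hχ₀⟩ : ∃ χ, MaxUSW likes χ := by
    obtain ⟨χ, hχ, hmax⟩ := Set.exists_max_image {χ | IsAlloc likes χ} usw (Set.toFinite _)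
      ⟨fun _ => none, fun o j h => by simp at h⟩
    exact ⟨χ, hχ, hmax⟩
  obtain ⟨χ, hχ, hmin⟩ := Set.exists_min_image {χ | MaxUSW likes χ}
    (fun χ => ∑ j, prof χ j ^ 2) (Set.toFinite _) ⟨χ₀, hχ₀⟩
  refine ⟨χ, hχ, ?_⟩
  rintro ⟨_, _, ⟨k, -, a, ha, rfl, rfl, o, ho⟩, hgap⟩
  obtain ⟨χ', hχ', hmove⟩ := exists_alloc_of_path k hχ.1 a ha o ho
  have husw : usw χ' = usw χ := sum_eq_of_move hmove
  exact (sum_sq_lt_of_move hmove hgap).not_ge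
    (hmin χ' ⟨hχ', fun ψ hψ => husw ▸ hχ.2 ψ hψ⟩)
end

section
/- Let x be a stable divisible allocation. Then x is LexiMin-optimal: for every max-USW divisible allocation x', the profile of x sorted in ascending order is greater than or equal to the profile of x' sorted in ascending order, in the lexicographic order. -/
open Finset

/-- `x` is a divisible allocation of `m` divisible items to `n` agents respecting `likes`:
fractions are nonnegative, zero on disliked items, and each item is allocated to total
extent at most `1`. -/
def IsDAlloc {m n : ℕ} (likes : Fin n → Fin m → Prop) (x : Fin m → Fin n → ℝ) : Prop :=
  (∀ o j, 0 ≤ x o j) ∧ (∀ o j, ¬ likes j o → x o j = 0) ∧ (∀ o, ∑ j, x o j ≤ 1)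

/-- The profile of a divisible allocation: agent `j` receives total amount `dprof x j`. -/
def dprof {m n : ℕ} (x : Fin m → Fin n → ℝ) (j : Fin n) : ℝ := ∑ o, x o j

/-- A max-USW divisible allocation: the total allocated amount is maximal. -/
def DMaxUSW {m n : ℕ} (likes : Fin n → Fin m → Prop) (x : Fin m → Fin n → ℝ) : Prop :=
  IsDAlloc likes x ∧
    ∀ x', IsDAlloc likes x' → ∑ o, ∑ j, x' o j ≤ ∑ o, ∑ j, x o j

/-- A transfer path in a divisible allocation `x` from agent `u` to agent `v`: pairwise
distinct agents `a 0 = u, …, a k = v` (`k ≥ 1`) and items `o 0, …, o (k-1)` with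
`x (o t) (a t) > 0` and agent `a (t+1)` liking `o t`. -/
def DTransferPath {m n : ℕ} (likes : Fin n → Fin m → Prop) (x : Fin m → Fin n → ℝ)
    (u v : Fin n) : Prop :=
  ∃ k : ℕ, 1 ≤ k ∧ ∃ a : Fin (k + 1) → Fin n, Function.Injective a ∧
    a 0 = u ∧ a (Fin.last k) = v ∧
    ∃ o : Fin k → Fin m, ∀ t : Fin k,
      0 < x (o t) (a t.castSucc) ∧ likes (a t.succ) (o t)

/-- `x` admits a narrowing transfer: a transfer path from `u` to `v` with `h_u > h_v`. -/
def DNarrowing {m n : ℕ} (likes : Fin n → Fin m → Prop) (x : Fin m → Fin n → ℝ) : Prop :=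
  ∃ u v, DTransferPath likes x u v ∧ dprof x v < dprof x u

/-- A stable divisible allocation: max-USW and admitting no narrowing transfer. -/
def DStable {m n : ℕ} (likes : Fin n → Fin m → Prop) (x : Fin m → Fin n → ℝ) : Prop :=
  DMaxUSW likes x ∧ ¬ DNarrowing likes x

/-- The profile of `x` sorted in ascending order. -/
noncomputable def sortedDProf {m n : ℕ} (x : Fin m → Fin n → ℝ) : Fin n → ℝ :=
  dprof x ∘ Tuple.sort (dprof x)

/-- In a max-USW divisible allocation every item liked by some agent is fully allocated. -/
theorem DMaxUSW.sum_eq_one {m n : ℕ} {likes : Fin n → Fin m → Prop} {x : Fin m → Fin n → ℝ}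
    (hx : DMaxUSW likes x) {o : Fin m} {j : Fin n} (hl : likes j o) : ∑ i, x o i = 1 := by
  classical
  obtain ⟨⟨hnn, hdis, hle⟩, hmax⟩ := hx
  refine le_antisymm (hle o) ?_
  set d := 1 - ∑ i, x o i with hd
  have hd0 : 0 ≤ d := sub_nonneg.2 (hle o)
  have hsum : ∀ p, ∑ i, (x p i + if p = o then (if i = j then d else 0) else 0)
      = ∑ i, x p i + if p = o then d else 0 := by
    intro p
    rw [Finset.sum_add_distrib]
    split_ifs <;> simp
  have h := hmax (fun p i => x p i + if p = o then (if i = j then d else 0) else 0) <| by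
    refine ⟨fun p i => ?_, fun p i hpi => ?_, fun p => ?_⟩
    · have := hnn p i
      dsimp only
      split_ifs <;> linarith
    · dsimp only
      rw [hdis p i hpi]
      split_ifs with h₁ h₂
      · subst h₁ h₂
        exact absurd hl hpi
      all_goals simp
    · rw [hsum]
      split_ifs with h₁
      · subst h₁
        linarith
      · simpa using hle p
  simp only [hsum, Finset.sum_add_distrib, Finset.sum_ite_eq', Finset.mem_univ, if_true] at h
  linarith

/-- In a stable divisible allocation no owner of part of an item has a larger amount than an
agent who likes that item. -/
theorem DStable.dprof_le {m n : ℕ} {likes : Fin n → Fin m → Prop} {x : Fin m → Fin n → ℝ}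
    (hx : DStable likes x) {o : Fin m} {i j : Fin n} (hi : 0 < x o i) (hj : likes j o) :
    dprof x i ≤ dprof x j := by
  by_contra! hlt
  have hne : i ≠ j := by
    rintro rfl
    exact lt_irrefl _ hlt
  refine hx.2 ⟨i, j, ⟨1, le_rfl, ![i, j], ?_, rfl, rfl, fun _ => o, ?_⟩, hlt⟩
  · intro a b
    fin_cases a <;> fin_cases b <;> simp [hne, hne.symm]
  · intro t
    fin_cases t
    exact ⟨hi, hj⟩

/-- Among the agents whose amount in a stable allocation is at most `c`, the total amount is
the largest that any divisible allocation can give them. -/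
theorem DStable.sum_dprof_le {m n : ℕ} {likes : Fin n → Fin m → Prop} {x : Fin m → Fin n → ℝ}
    (hx : DStable likes x) {x' : Fin m → Fin n → ℝ} (hx' : IsDAlloc likes x') (c : ℝ) :
    ∑ j with dprof x j ≤ c, dprof x' j ≤ ∑ j with dprof x j ≤ c, dprof x j := by
  obtain ⟨hnn', hdis', hle'⟩ := hx'
  have hnn := hx.1.1.1
  simp only [dprof.eq_def x', dprof.eq_def x]
  rw [Finset.sum_comm, Finset.sum_comm (s := {j | ∑ o, x o j ≤ c})]
  simp only [← dprof.eq_def x]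
  refine Finset.sum_le_sum fun o _ => ?_
  by_cases h : ∃ j, dprof x j ≤ c ∧ likes j o
  · obtain ⟨j, hjc, hj⟩ := h
    calc ∑ i with dprof x i ≤ c, x' o i ≤ ∑ i, x' o i :=
          Finset.sum_le_sum_of_subset_of_nonneg (Finset.filter_subset _ _)
            fun i _ _ => hnn' o i
      _ ≤ 1 := hle' o
      _ = ∑ i, x o i := (hx.1.sum_eq_one hj).symm
      _ = ∑ i with dprof x i ≤ c, x o i := by
        refine (Finset.sum_subset (Finset.filter_subset _ _) fun i _ hi => ?_).symm
        by_contra hne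
        have hpos := lt_of_le_of_ne (hnn o i) (Ne.symm hne)
        exact hi (by simpa using (hx.dprof_le hpos hj).trans hjc)
  · push Not at h
    rw [Finset.sum_eq_zero fun i hi => hdis' o i (h i (by simpa using hi))]
    exact Finset.sum_nonneg fun i _ => hnn o i

/-- A stable divisible allocation minimizes the total shortfall below any level `c`. -/
theorem DStable.sum_shortfall_le {m n : ℕ} {likes : Fin n → Fin m → Prop}
    {x : Fin m → Fin n → ℝ} (hx : DStable likes x) {x' : Fin m → Fin n → ℝ}
    (hx' : IsDAlloc likes x') (c : ℝ) :
    ∑ j, max (c - dprof x j) 0 ≤ ∑ j, max (c - dprof x' j) 0 := by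
  calc ∑ j, max (c - dprof x j) 0 = ∑ j with dprof x j ≤ c, (c - dprof x j) := by
        rw [Finset.sum_filter]
        refine Finset.sum_congr rfl fun j _ => ?_
        split_ifs with h
        · exact max_eq_left (sub_nonneg.2 h)
        · exact max_eq_right (sub_nonpos.2 (not_le.1 h).le)
    _ ≤ ∑ j with dprof x j ≤ c, (c - dprof x' j) := by
        rw [Finset.sum_sub_distrib, Finset.sum_sub_distrib]
        exact sub_le_sub_left (hx.sum_dprof_le hx' c) _
    _ ≤ ∑ j with dprof x j ≤ c, max (c - dprof x' j) 0 :=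
        Finset.sum_le_sum fun j _ => le_max_left _ _
    _ ≤ ∑ j, max (c - dprof x' j) 0 :=
        Finset.sum_le_sum_of_subset_of_nonneg (Finset.filter_subset _ _)
          fun j _ _ => le_max_right _ _

/-- A monotone sequence that is lexicographically smaller than another has a strictly larger
total shortfall below some level. -/
theorem exists_sum_shortfall_lt {n : ℕ} {s t : Fin n → ℝ} (ht : Monotone t)
    (h : toLex s < toLex t) : ∃ c, ∑ i, max (c - t i) 0 < ∑ i, max (c - s i) 0 := by
  obtain ⟨k, heq, hlt⟩ := h
  simp only [Pi.toLex_apply] at heq hlt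
  refine ⟨t k, Finset.sum_lt_sum (fun i _ => ?_) ⟨k, Finset.mem_univ k, ?_⟩⟩
  · rcases lt_or_ge i k with hi | hi
    · rw [heq i hi]
    · rw [max_eq_right (sub_nonpos.2 (ht hi))]
      exact le_max_right _ _
  · rw [sub_self, max_self]
    exact lt_max_of_lt_left (sub_pos.2 hlt)

/-- a stable divisible allocation is LexiMin-optimal: its ascending-sorted
profile is lexicographically greater than or equal to that of any max-USW divisible
allocation. -/
theorem dstable_lexiMin_optimal {m n : ℕ} (likes : Fin n → Fin m → Prop)
    (x : Fin m → Fin n → ℝ) (hx : DStable likes x)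
    (x' : Fin m → Fin n → ℝ) (hx' : DMaxUSW likes x') :
    toLex (sortedDProf x') ≤ toLex (sortedDProf x) := by
  by_contra! hlt
  obtain ⟨c, hc⟩ := exists_sum_shortfall_lt (Tuple.monotone_sort (dprof x')) hlt
  have hperm : ∀ y : Fin m → Fin n → ℝ,
      ∑ i, max (c - sortedDProf y i) 0 = ∑ j, max (c - dprof y j) 0 := fun y =>
    Equiv.sum_comp (Tuple.sort (dprof y)) fun j => max (c - dprof y j) 0
  have hle := hx.sum_shortfall_le hx'.1 c
  rw [← hperm x, ← hperm x'] at hle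
  exact hle.not_gt hc
end

section
/- For every instance (any relation 'agent j likes item o' between m divisible items and n agents), there exists a stable divisible allocation, i.e. a max-USW divisible allocation admitting no narrowing transfer. -/
open Finset

theorem isCompact_setOf_isDAlloc {m n : ℕ} (likes : Fin n → Fin m → Prop) :
    IsCompact {x : Fin m → Fin n → ℝ | IsDAlloc likes x} := by
  refine (isCompact_Icc (a := (0 : Fin m → Fin n → ℝ)) (b := 1)).of_isClosed_subset ?_ ?_
  · simp only [IsDAlloc, Set.ofPred_and, Set.ofPred_forall]
    refine IsClosed.inter ?_ (IsClosed.inter ?_ ?_)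
    · exact isClosed_iInter fun o => isClosed_iInter fun j =>
        isClosed_le continuous_const (by fun_prop)
    · exact isClosed_iInter fun o => isClosed_iInter fun j => isClosed_iInter fun _ =>
        isClosed_eq (by fun_prop) continuous_const
    · exact isClosed_iInter fun o => isClosed_le (by fun_prop) continuous_const
  · rintro x ⟨h0, -, h1⟩
    exact ⟨h0, fun o j =>
      (single_le_sum (fun i _ => h0 o i) (mem_univ j)).trans (h1 o)⟩

/-- Among the max-USW divisible allocations, one minimizes the sum of squared utilities. -/
theorem exists_dMaxUSW_min_sum_sq {m n : ℕ} (likes : Fin n → Fin m → Prop) :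
    ∃ x, DMaxUSW likes x ∧
      ∀ y, DMaxUSW likes y → ∑ j, dprof x j ^ 2 ≤ ∑ j, dprof y j ^ 2 := by
  have hc := isCompact_setOf_isDAlloc likes
  have hne : {x : Fin m → Fin n → ℝ | IsDAlloc likes x}.Nonempty := ⟨0, by simp [IsDAlloc]⟩
  obtain ⟨z, hz, hzmax⟩ := hc.exists_isMaxOn (f := fun x => ∑ o, ∑ j, x o j) hne (by fun_prop)
  have hcl : IsClosed {x : Fin m → Fin n → ℝ | ∑ o, ∑ j, z o j ≤ ∑ o, ∑ j, x o j} :=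
    isClosed_le continuous_const (by fun_prop)
  obtain ⟨x, ⟨hx, hxz⟩, hxmin⟩ := (hc.inter_right hcl).exists_isMinOn
    (f := fun x => ∑ j, dprof x j ^ 2) ⟨z, hz, le_refl (∑ o, ∑ j, z o j)⟩ (by unfold dprof; fun_prop)
  exact ⟨x, ⟨hx, fun y hy => (hzmax hy).trans hxz⟩, fun y hy => hxmin ⟨hy.1, hy.2 z hz⟩⟩

/-- Moving part of an item from a richer agent to a poorer one that likes it keeps an
allocation max-USW and strictly lowers the sum of squared utilities. -/
theorem DMaxUSW.exists_sum_sq_lt {m n : ℕ} {likes : Fin n → Fin m → Prop}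
    {x : Fin m → Fin n → ℝ} (hx : DMaxUSW likes x) {u v : Fin n} {p : Fin m}
    (hpu : 0 < x p u) (hpv : likes v p) (huv : dprof x v < dprof x u) :
    ∃ y, DMaxUSW likes y ∧ ∑ j, dprof y j ^ 2 < ∑ j, dprof x j ^ 2 := by
  obtain ⟨⟨h0, hlikes, h1⟩, hmax⟩ := hx
  have hne : u ≠ v := by rintro rfl; exact lt_irrefl _ huv
  obtain ⟨ε, hε, hεx, hεh⟩ : ∃ ε : ℝ, 0 < ε ∧ ε ≤ x p u ∧ ε < dprof x u - dprof x v :=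
    ⟨min (x p u) ((dprof x u - dprof x v) / 2), lt_min hpu (by linarith), min_le_left _ _,
      (min_le_right _ _).trans_lt (by linarith)⟩
  let d : Fin n → ℝ := fun j => (if j = v then 1 else 0) - (if j = u then 1 else 0)
  have hd : ∑ j, d j = 0 := by simp [d]
  have hhd : ∑ j, dprof x j * d j = dprof x v - dprof x u := by simp [d, mul_sub]
  have hdd : ∑ j, d j ^ 2 = 2 := by
    have h (j : Fin n) : d j ^ 2 = (if j = v then 1 else 0) + (if j = u then 1 else 0) := by
      by_cases hu : j = u
      · simp [d, hu, hne]
      · simp [d, hu]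
    simp only [h, sum_add_distrib, sum_ite_eq', mem_univ, if_true]
    norm_num
  let y : Fin m → Fin n → ℝ := fun o j => x o j + if o = p then ε * d j else 0
  have hrow (o : Fin m) : ∑ j, y o j = ∑ j, x o j := by
    by_cases ho : o = p <;> simp [y, ho, sum_add_distrib, ← mul_sum, hd]
  have hprof (j : Fin n) : dprof y j = dprof x j + ε * d j := by
    simp [dprof, y, sum_add_distrib]
  refine ⟨y, ⟨⟨fun o j => ?_, fun o j hj => ?_, fun o => (hrow o).trans_le (h1 o)⟩,
    fun z hz => by simpa only [hrow] using hmax z hz⟩, ?_⟩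
  · have := h0 o j
    by_cases ho : o = p
    · by_cases hu : j = u
      · simp [y, d, ho, hu, hne, hεx]
      · by_cases hv : j = v
        · subst ho hv; simp [y, d, hu]; linarith
        · simpa [y, d, ho, hu, hv] using h0 p j
    · simpa [y, ho] using this
  · have hxo := hlikes o j hj
    by_cases ho : o = p
    · have hv : j ≠ v := by rintro rfl; exact hj (ho ▸ hpv)
      have hu : j ≠ u := by rintro rfl; rw [ho] at hxo; exact hpu.ne' hxo
      simp [y, d, hxo, hu, hv]
    · simp [y, ho, hxo]
  · have hsum : ∑ j, dprof y j ^ 2 = ∑ j, dprof x j ^ 2 +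
        2 * ε * ∑ j, dprof x j * d j + ε ^ 2 * ∑ j, d j ^ 2 := by
      simp only [hprof, mul_sum, ← sum_add_distrib]
      exact sum_congr rfl fun j _ => by ring
    rw [hsum, hhd, hdd]
    nlinarith

/-- A narrowing transfer contains a single step from a richer agent to a poorer one. -/
theorem DNarrowing.exists_step {m n : ℕ} {likes : Fin n → Fin m → Prop}
    {x : Fin m → Fin n → ℝ} (h : DNarrowing likes x) :
    ∃ u v p, 0 < x p u ∧ likes v p ∧ dprof x v < dprof x u := by
  obtain ⟨u, v, ⟨k, -, a, -, rfl, rfl, o, ho⟩, huv⟩ := h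
  by_contra! hstep
  have hmono : Monotone fun t => dprof x (a t) :=
    Fin.monotone_iff_le_succ.2 fun t => hstep _ _ _ (ho t).1 (ho t).2
  exact huv.not_ge (hmono (Fin.zero_le _))

/-- for every instance, a stable divisible allocation exists. -/
theorem dstable_alloc_exists {m n : ℕ} (likes : Fin n → Fin m → Prop) :
    ∃ x : Fin m → Fin n → ℝ, DStable likes x := by
  obtain ⟨x, hx, hmin⟩ := exists_dMaxUSW_min_sum_sq likes
  refine ⟨x, hx, fun hnar => ?_⟩
  obtain ⟨u, v, p, hpu, hpv, huv⟩ := hnar.exists_step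
  obtain ⟨y, hy, hlt⟩ := hx.exists_sum_sq_lt hpu hpv huv
  exact (hmin y hy).not_gt hlt
end

section
/- Let x be a stable divisible allocation with profile h. Then for any two agents i and j, either h_i = h_j or |h_i − h_j| ≥ 1/n². That is, any two distinct income values (layers) of a stable divisible allocation differ by at least 1/n². -/
open Finset

/-- Along a single item, income cannot drop from an owner to another agent liking the item. -/
theorem DStable.dprof_le_of_pos_of_likes {m n : ℕ} {likes : Fin n → Fin m → Prop}
    {x : Fin m → Fin n → ℝ} (hx : DStable likes x) {o : Fin m} {u v : Fin n}
    (hu : 0 < x o u) (hv : likes v o) : dprof x u ≤ dprof x v := by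
  by_contra! hlt
  have huv : u ≠ v := fun h => (h ▸ hlt).false
  refine hx.2 ⟨u, v, ⟨1, le_rfl, ![u, v], ?_, rfl, rfl, fun _ => o, ?_⟩, hlt⟩
  · intro s t hst
    fin_cases s <;> fin_cases t <;> simp_all
  · intro t
    fin_cases t
    exact ⟨hu, hv⟩

theorem IsDAlloc.likes_of_pos {m n : ℕ} {likes : Fin n → Fin m → Prop}
    {x : Fin m → Fin n → ℝ} (hx : IsDAlloc likes x) {o : Fin m} {u : Fin n}
    (hu : 0 < x o u) : likes u o := by
  by_contra h
  exact hu.ne' (hx.2.1 o u h)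

/-- In a max-USW divisible allocation every item liked by someone is fully allocated. -/
theorem DMaxUSW.sum_eq_one_of_likes {m n : ℕ} {likes : Fin n → Fin m → Prop}
    {x : Fin m → Fin n → ℝ} (hx : DMaxUSW likes x) {o : Fin m} {u : Fin n}
    (hu : likes u o) : ∑ j, x o j = 1 := by
  obtain ⟨⟨hnonneg, hzero, hle⟩, hmax⟩ := hx
  refine le_antisymm (hle o) ?_
  set d : ℝ := 1 - ∑ j, x o j with hd
  have hd0 : 0 ≤ d := sub_nonneg.2 (hle o)
  have hrow : ∀ p, ∑ j, (x p j + if p = o ∧ j = u then d else 0) =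
      ∑ j, x p j + if p = o then d else 0 := by
    intro p
    by_cases hp : p = o <;> simp [hp, sum_add_distrib]
  have key := hmax (fun p j => x p j + if p = o ∧ j = u then d else 0) ⟨?_, ?_, ?_⟩
  · simp only [hrow, sum_add_distrib, sum_ite_eq', mem_univ, if_true] at key
    linarith
  · intro p j
    have := hnonneg p j
    dsimp only
    split_ifs <;> linarith
  · intro p j hpj
    have : ¬ (p = o ∧ j = u) := by
      rintro ⟨rfl, rfl⟩
      exact hpj hu
    simp [this, hzero p j hpj]
  · intro p
    rw [hrow]
    by_cases hp : p = o
    · subst hp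
      simp [hd]
    · simpa [hp] using hle p

/-- In a stable divisible allocation, the agents of a given income own each item either
entirely or not at all. -/
theorem DStable.sum_layer_eq_zero_or_one {m n : ℕ} {likes : Fin n → Fin m → Prop}
    {x : Fin m → Fin n → ℝ} (hx : DStable likes x) (c : ℝ) (o : Fin m) :
    ∑ j with dprof x j = c, x o j = 0 ∨ ∑ j with dprof x j = c, x o j = 1 := by
  have halloc := hx.1.1
  by_cases h : ∃ u, dprof x u = c ∧ 0 < x o u
  · obtain ⟨u, rfl, hu⟩ := h
    right
    rw [← hx.1.sum_eq_one_of_likes (halloc.likes_of_pos hu)]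
    refine sum_subset (filter_subset _ _) fun v _ hv => ?_
    by_contra hne
    have hpos : 0 < x o v := lt_of_le_of_ne (halloc.1 o v) (Ne.symm hne)
    refine hv (mem_filter.2 ⟨mem_univ v, le_antisymm ?_ ?_⟩)
    · exact hx.dprof_le_of_pos_of_likes hpos (halloc.likes_of_pos hu)
    · exact hx.dprof_le_of_pos_of_likes hu (halloc.likes_of_pos hpos)
  · push Not at h
    left
    refine sum_eq_zero fun v hv => ?_
    exact le_antisymm (h v (mem_filter.1 hv).2) (halloc.1 o v)

/-- In a stable divisible allocation, every income times the size of its layer is an integer. -/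
theorem DStable.exists_int_eq_card_layer_mul {m n : ℕ} {likes : Fin n → Fin m → Prop}
    {x : Fin m → Fin n → ℝ} (hx : DStable likes x) (c : ℝ) :
    ∃ p : ℤ, (#{j | dprof x j = c} : ℝ) * c = p := by
  have hshare : ∀ o, ∃ p : ℤ, ∑ j with dprof x j = c, x o j = p := fun o =>
    (hx.sum_layer_eq_zero_or_one c o).elim (fun h => ⟨0, by simpa using h⟩)
      fun h => ⟨1, by simpa using h⟩
  choose p hp using hshare
  refine ⟨∑ o, p o, ?_⟩
  push_cast
  simp only [← hp]
  rw [sum_comm, ← nsmul_eq_mul, ← sum_const]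
  exact sum_congr rfl fun j hj => (mem_filter.1 hj).2.symm

/-- Two distinct reals with denominators at most `N` differ by at least `1 / N²`. -/
theorem one_div_sq_le_abs_sub_of_mul_eq_int {a b : ℝ} {k l N : ℕ} {p q : ℤ}
    (hk : 0 < k) (hl : 0 < l) (hkN : k ≤ N) (hlN : l ≤ N)
    (ha : (k : ℝ) * a = p) (hb : (l : ℝ) * b = q) (hab : a ≠ b) :
    1 / (N : ℝ) ^ 2 ≤ |a - b| := by
  have hk' : (0 : ℝ) < k := by exact_mod_cast hk
  have hl' : (0 : ℝ) < l := by exact_mod_cast hl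
  have hN : (0 : ℝ) < N := by exact_mod_cast hk.trans_le hkN
  have heq : (k : ℝ) * l * (a - b) = ((l * p - k * q : ℤ) : ℝ) := by
    push_cast
    rw [← ha, ← hb]
    ring
  have hne : (l * p - k * q : ℤ) ≠ 0 := by
    intro h
    rw [h, Int.cast_zero] at heq
    exact mul_ne_zero (mul_pos hk' hl').ne' (sub_ne_zero.2 hab) heq
  have hone : (1 : ℝ) ≤ k * l * |a - b| := by
    rw [← abs_of_pos (mul_pos hk' hl'), ← abs_mul, heq]
    exact_mod_cast Int.one_le_abs hne
  have hkl : (k : ℝ) * l ≤ (N : ℝ) ^ 2 := by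
    rw [sq]
    exact_mod_cast Nat.mul_le_mul hkN hlN
  rw [div_le_iff₀ (by positivity), mul_comm]
  exact hone.trans (mul_le_mul_of_nonneg_right hkl (abs_nonneg _))

/-- in a stable divisible allocation, any two agents have either equal
incomes, or incomes differing by at least `1 / n²`. -/
theorem dstable_layer_gap {m n : ℕ} (likes : Fin n → Fin m → Prop)
    (x : Fin m → Fin n → ℝ) (hx : DStable likes x) :
    ∀ i j : Fin n, dprof x i = dprof x j ∨
      1 / (n : ℝ) ^ 2 ≤ |dprof x i - dprof x j| := by
  intro i j
  refine or_iff_not_imp_left.2 fun hij => ?_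
  obtain ⟨p, hp⟩ := hx.exists_int_eq_card_layer_mul (dprof x i)
  obtain ⟨q, hq⟩ := hx.exists_int_eq_card_layer_mul (dprof x j)
  exact one_div_sq_le_abs_sub_of_mul_eq_int
    (card_pos.2 ⟨i, by simp⟩) (card_pos.2 ⟨j, by simp⟩)
    (card_finset_fin_le _) (card_finset_fin_le _) hp hq hij
end

section
/- Suppose each agent's valuation is the rank function of a matroid on the items (binary submodular valuations). Let χ and χ' be two max-USW clean allocations that are both LexiMin-optimal, with profiles h and h' respectively. Then |h_i − h'_i| ≤ 1 for every agent i; in other words, the Chebyshev distance between their profiles is at most 1. -/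
open Finset

/-- A clean allocation for agents with matroid-rank (binary submodular) valuations:
the bundles are pairwise disjoint and the bundle of agent `i` is independent in the
matroid `M i`. -/
def CleanAlloc {m n : ℕ} (M : Fin n → Matroid (Fin m)) (χ : Fin n → Finset (Fin m)) :
    Prop :=
  (∀ i j, i ≠ j → Disjoint (χ i) (χ j)) ∧ ∀ i, (M i).Indep ↑(χ i)

/-- A max-USW clean allocation: the total size `∑ i, |χ i|` is maximal among clean
allocations. -/
def MaxUSWClean {m n : ℕ} (M : Fin n → Matroid (Fin m)) (χ : Fin n → Finset (Fin m)) :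
    Prop :=
  CleanAlloc M χ ∧ ∀ χ', CleanAlloc M χ' → ∑ i, (χ' i).card ≤ ∑ i, (χ i).card

/-- The profile `(|χ 1|, …, |χ n|)` sorted in ascending order. -/
noncomputable def sortedProfS {m n : ℕ} (χ : Fin n → Finset (Fin m)) : Fin n → ℕ :=
  (fun i => (χ i).card) ∘ Tuple.sort (fun i => (χ i).card)

/-- A LexiMin-optimal allocation: max-USW and clean, with ascending-sorted profile
lexicographically greater than or equal to that of every max-USW clean allocation. -/
def LexiMinOpt {m n : ℕ} (M : Fin n → Matroid (Fin m)) (χ : Fin n → Finset (Fin m)) :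
    Prop :=
  MaxUSWClean M χ ∧ ∀ χ', MaxUSWClean M χ' → toLex (sortedProfS χ') ≤ toLex (sortedProfS χ)

namespace Matroid

variable {α : Type*} {M : Matroid α}

/-- If `J` and `I ∋ a` are independent and `insert a J` is not, some element of `J \ I` can be
traded for `a`. -/
theorem Indep.exists_mem_diff_insert_diff_indep {I J : Set α} {a : α} (hI : M.Indep I)
    (hJ : M.Indep J) (ha : a ∈ I) (hdep : ¬ M.Indep (insert a J)) :
    ∃ b ∈ J \ I, M.Indep (insert a J \ {b}) := by
  have hground : insert a J ⊆ M.E := Set.insert_subset (hI.subset_ground ha) hJ.subset_ground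
  obtain ⟨C, hCJ, hC⟩ := ((not_indep_iff hground).1 hdep).exists_isCircuit_subset
  obtain ⟨b, hbC, hbI⟩ := Set.not_subset.1 fun h => hC.not_indep (hI.subset h)
  refine ⟨b, ⟨(hCJ hbC).resolve_left fun h => hbI (h ▸ ha), hbI⟩, ?_⟩
  by_contra hcon
  obtain ⟨C', hC'J, hC'⟩ :=
    ((not_indep_iff (Set.sdiff_subset.trans hground)).1 hcon).exists_isCircuit_subset
  have hCC' : C = C' := (hC.eq_fundCircuit_of_subset hJ hCJ).trans
    (hC'.eq_fundCircuit_of_subset hJ (hC'J.trans Set.sdiff_subset)).symm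
  exact (hC'J (hCC' ▸ hbC)).2 rfl

variable {κ : Type*} [Fintype α] [DecidableEq α] [DecidableEq κ]

/-- An item `a` removed from an assignment `A` of items to matroids can be put back, keeping all
fibers independent, so that only one fiber grows, and that fiber was smaller than the one of the
reference assignment `B`. -/
theorem exists_assignment_insert (M : κ → Matroid α) (B : α → κ)
    (hB : ∀ k, (M k).Indep {e | B e = k}) (A : α → κ) (a : α)
    (hA : ∀ k, (M k).Indep {e | e ≠ a ∧ A e = k}) :
    ∃ (A' : α → κ) (j : κ), (∀ k, (M k).Indep {e | A' e = k}) ∧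
      #{e | e ≠ a ∧ A e = j} < #{e | B e = j} ∧
      ∀ k, #{e | A' e = k} = #{e | e ≠ a ∧ A e = k} + if k = j then 1 else 0 := by
  induction hd : #{e | e ≠ a ∧ A e ≠ B e} using Nat.strong_induction_on generalizing A a with
  | _ d ih =>
  have key : (∃ b, b ≠ a ∧ A b = B a ∧ B b ≠ B a ∧
      (M (B a)).Indep (insert a {e | e ≠ a ∧ A e = B a} \ {b})) ∨
      ((M (B a)).Indep (insert a {e | e ≠ a ∧ A e = B a}) ∧
        #{e | e ≠ a ∧ A e = B a} < #{e | B e = B a}) := by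
    by_cases hi : (M (B a)).Indep (insert a {e | e ≠ a ∧ A e = B a})
    · by_cases hc : #{e | e ≠ a ∧ A e = B a} < #{e | B e = B a}
      · exact .inr ⟨hi, hc⟩
      · have hns : ¬ ({e | e ≠ a ∧ A e = B a} : Finset α) ⊆ ({e | B e = B a} : Finset α) := fun hss => by
          have := Finset.eq_of_subset_of_card_le hss (not_lt.1 hc)
          have ha : a ∈ ({e | B e = B a} : Finset α) := by simp
          rw [← this] at ha
          simp at ha
        obtain ⟨b, hb, hb'⟩ := Finset.not_subset.1 hns
        simp only [mem_filter, mem_univ, true_and] at hb hb'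
        exact .inl ⟨b, hb.1, hb.2, hb', hi.subset Set.sdiff_subset⟩
    · obtain ⟨b, hb, hb'⟩ := (hB (B a)).exists_mem_diff_insert_diff_indep (hA (B a)) rfl hi
      exact .inl ⟨b, hb.1.1, hb.1.2, hb.2, hb'⟩
  have hupd : ∀ k ≠ B a, ∀ e, Function.update A a (B a) e = k ↔ e ≠ a ∧ A e = k := by
    intro k hk e
    by_cases he : e = a
    · subst he; simp [hk.symm]
    · simp [he]
  have hupd' : ∀ e, Function.update A a (B a) e = B a ↔ e = a ∨ (e ≠ a ∧ A e = B a) := by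
    intro e
    by_cases he : e = a
    · subst he; simp
    · simp [he]
  rcases key with ⟨b, hba, hAb, hBb, hind⟩ | ⟨hind, hlt⟩
  · have hcard : ∀ k, #{e | e ≠ b ∧ Function.update A a (B a) e = k} = #{e | e ≠ a ∧ A e = k} := by
      intro k
      by_cases hk : k = B a
      · subst hk
        have h1 : ({e | e ≠ b ∧ Function.update A a (B a) e = B a} : Finset α)
            = insert a (({e | e ≠ a ∧ A e = B a} : Finset α).erase b) := by
          ext e
          simp only [mem_filter, mem_univ, true_and, mem_insert, mem_erase, hupd']
          grind
        rw [h1, Finset.card_insert_of_notMem (by simp), Finset.card_erase_add_one (by simp [*])]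
      · congr 1
        ext e
        simp only [mem_filter, mem_univ, true_and, hupd k hk]
        grind
    obtain ⟨A', j, h1, h2, h3⟩ := ih _ (by
        rw [← hd]
        apply Finset.card_lt_card
        rw [Finset.ssubset_iff_of_subset]
        · exact ⟨b, by simp [hba, hAb, hBb.symm], by simp⟩
        · intro e
          by_cases he : e = a
          · subst he; simp
          · simp [he]) (Function.update A a (B a)) b (by
        intro k
        by_cases hk : k = B a
        · subst hk
          refine hind.subset fun e he => ?_
          simp only [Set.mem_ofPred_eq, hupd'] at he
          exact ⟨he.2, he.1⟩
        · refine (hA k).subset fun e he => ?_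
          simp only [Set.mem_ofPred_eq, hupd k hk] at he
          exact he.2) rfl
    simp only [hcard] at h2 h3
    exact ⟨A', j, h1, h2, h3⟩
  · refine ⟨Function.update A a (B a), B a, fun k => ?_, hlt, fun k => ?_⟩
    · by_cases hk : k = B a
      · subst hk
        refine hind.subset fun e he => ?_
        exact (hupd' e).1 he
      · refine (hA k).subset fun e he => ?_
        simpa only [Set.mem_ofPred_eq, hupd k hk] using he
    · by_cases hk : k = B a
      · subst hk
        have h1 : ({e | Function.update A a (B a) e = B a} : Finset α)
            = insert a ({e | e ≠ a ∧ A e = B a} : Finset α) := by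
          ext e
          simp only [mem_filter, mem_univ, true_and, mem_insert, hupd']
        rw [h1, Finset.card_insert_of_notMem (by simp), if_pos rfl]
      · simp only [hupd k hk, if_neg hk, add_zero]

/-- One-sided exchange for fiber sizes of assignments with independent fibers. -/
theorem exists_assignment_exchange (M : κ → Matroid α) (A B : α → κ)
    (hA : ∀ k, (M k).Indep {e | A e = k}) (hB : ∀ k, (M k).Indep {e | B e = k}) (i : κ)
    (hi : #{e | B e = i} < #{e | A e = i}) :
    ∃ (A' : α → κ) (j : κ), (∀ k, (M k).Indep {e | A' e = k}) ∧
      #{e | A e = j} < #{e | B e = j} ∧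
      ∀ k, #{e | A' e = k} + (if k = i then 1 else 0) =
        #{e | A e = k} + if k = j then 1 else 0 := by
  obtain ⟨a, ha⟩ := Finset.card_pos.1 (Nat.zero_lt_of_lt hi)
  obtain rfl : A a = i := by simpa using ha
  have hcard : ∀ k, #{e | e ≠ a ∧ A e = k} + (if k = A a then 1 else 0) = #{e | A e = k} := by
    intro k
    have h1 : ({e | e ≠ a ∧ A e = k} : Finset α) = ({e | A e = k} : Finset α).erase a := by
      ext e; simp
    rw [h1]
    split_ifs with hk
    · exact Finset.card_erase_add_one (by simp [hk])
    · rw [Finset.erase_eq_of_notMem (by simpa using Ne.symm hk), add_zero]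
  obtain ⟨A', j, h1, h2, h3⟩ := exists_assignment_insert M B hB A a
    fun k => (hA k).subset fun e he => he.2
  refine ⟨A', j, h1, ?_, fun k => ?_⟩
  · have := hcard j
    split_ifs at this with hj
    · subst hj; omega
    · omega
  · rw [h3, ← hcard k]; omega

end Matroid

section Allocations

variable {m n : ℕ} {M : Fin n → Matroid (Fin m)}

/-- The agent holding an item, or `none` if the item is unallocated. -/
noncomputable def allocOwner (χ : Fin n → Finset (Fin m)) (e : Fin m) : Option (Fin n) :=
  open Classical in if h : ∃ i, e ∈ χ i then some h.choose else none

theorem CleanAlloc.allocOwner_eq_some_iff {χ : Fin n → Finset (Fin m)} (h : CleanAlloc M χ)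
    {e : Fin m} {i : Fin n} : allocOwner χ e = some i ↔ e ∈ χ i := by
  unfold allocOwner
  split_ifs with he
  · rw [Option.some_inj]
    refine ⟨fun hi => hi ▸ he.choose_spec, fun hi => ?_⟩
    by_contra hne
    exact Finset.disjoint_left.1 (h.1 _ _ hne) he.choose_spec hi
  · simpa using fun hi => he ⟨i, hi⟩

theorem sum_card_fiber_some_add_card_fiber_none (A : Fin m → Option (Fin n)) :
    ∑ i, #{e | A e = some i} + #{e | A e = none} = m := by
  have := Finset.card_eq_sum_card_fiberwise (f := A) (s := univ) (t := univ) (by simp)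
  rw [Fintype.sum_option, Finset.card_univ, Fintype.card_fin] at this
  omega

/-- Moving one unit from `i` to `j` keeps the total. -/
theorem sum_eq_of_transfer {x z : Fin n → ℕ} {i j : Fin n}
    (hz : ∀ k, z k + (if k = i then 1 else 0) = x k + if k = j then 1 else 0) :
    ∑ k, z k = ∑ k, x k := by
  have := Finset.sum_congr rfl fun k (_ : k ∈ univ) => hz k
  simpa [Finset.sum_add_distrib] using this

/-- One-sided exchange for the profiles of max-USW clean allocations. -/
theorem MaxUSWClean.exists_exchange {χ ψ : Fin n → Finset (Fin m)} (hχ : MaxUSWClean M χ)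
    (hψ : MaxUSWClean M ψ) {i : Fin n} (hi : (ψ i).card < (χ i).card) :
    ∃ (ω : Fin n → Finset (Fin m)) (j : Fin n), MaxUSWClean M ω ∧ (χ j).card < (ψ j).card ∧
      ∀ k, (ω k).card + (if k = i then 1 else 0) = (χ k).card + if k = j then 1 else 0 := by
  let N : Option (Fin n) → Matroid (Fin m) := fun o => o.elim (Matroid.freeOn Set.univ) M
  have hind : ∀ {χ : Fin n → Finset (Fin m)}, CleanAlloc M χ →
      ∀ k, (N k).Indep {e | allocOwner χ e = k} := by
    rintro χ h (_ | k)
    · simp [N]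
    · simp only [h.allocOwner_eq_some_iff]
      exact h.2 k
  have hcard : ∀ {χ : Fin n → Finset (Fin m)}, CleanAlloc M χ →
      ∀ k, #{e | allocOwner χ e = some k} = (χ k).card := by
    intro χ h k
    simp [h.allocOwner_eq_some_iff]
  have hnone : #{e | allocOwner χ e = none} = #{e | allocOwner ψ e = none} := by
    have h1 := sum_card_fiber_some_add_card_fiber_none (allocOwner χ)
    have h2 := sum_card_fiber_some_add_card_fiber_none (allocOwner ψ)
    simp only [hcard hχ.1] at h1
    simp only [hcard hψ.1] at h2
    have h3 := hχ.2 ψ hψ.1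
    have h4 := hψ.2 χ hχ.1
    omega
  obtain ⟨A, j, hA, hj, hAc⟩ := Matroid.exists_assignment_exchange N (allocOwner χ)
    (allocOwner ψ) (hind hχ.1) (hind hψ.1) (some i) (by rwa [hcard hχ.1, hcard hψ.1])
  obtain _ | j := j
  · omega
  have htransfer : ∀ k, #{e | A e = some k} + (if k = i then 1 else 0) =
      (χ k).card + if k = j then 1 else 0 := by
    intro k
    simpa [hcard hχ.1] using hAc (some k)
  refine ⟨fun k => {e | A e = some k}, j, ⟨⟨?_, ?_⟩, fun χ' h' => ?_⟩, ?_, htransfer⟩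
  · intro k l hkl
    rw [Finset.disjoint_left]
    intro e hk hl
    simp only [mem_filter, mem_univ, true_and] at hk hl
    exact hkl (Option.some_inj.1 (hk.symm.trans hl))
  · intro k
    simpa [N] using hA (some k)
  · exact (hχ.2 χ' h').trans_eq (sum_eq_of_transfer htransfer).symm
  · rwa [hcard hχ.1, hcard hψ.1] at hj

end Allocations

section SortedTuples

variable {n : ℕ}

theorem card_filter_comp_perm_le (x : Fin n → ℕ) (σ : Equiv.Perm (Fin n)) (v : ℕ) :
    #{k | (x ∘ σ) k ≤ v} = #{k | x k ≤ v} :=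
  Finset.card_equiv σ (by simp)

/-- A monotone tuple with as many entries `≤ u` for `u < v`, but fewer entries `≤ v`, is
lexicographically larger. -/
theorem toLex_lt_of_card_filter_le {s t : Fin n → ℕ} (hs : Monotone s) (ht : Monotone t) (v : ℕ)
    (heq : ∀ u < v, #{k | t k ≤ u} = #{k | s k ≤ u})
    (hlt : #{k | t k ≤ v} < #{k | s k ≤ v}) : toLex s < toLex t := by
  have hs' : ∀ (p : Fin n) (u : ℕ), (p : ℕ) < #{k | s k ≤ u} ↔ s p ≤ u :=
    fun p u => Tuple.lt_card_le_iff_apply_le_of_monotone hs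
  have ht' : ∀ (p : Fin n) (u : ℕ), (p : ℕ) < #{k | t k ≤ u} ↔ t p ≤ u :=
    fun p u => Tuple.lt_card_le_iff_apply_le_of_monotone ht
  have hn : #{k | t k ≤ v} < n :=
    hlt.trans_le ((Finset.card_le_univ _).trans_eq (Fintype.card_fin n))
  refine ⟨⟨_, hn⟩, fun p hp => ?_, ?_⟩
  · have hp : (p : ℕ) < #{k | t k ≤ v} := hp
    have h1 := (ht' p v).1 hp
    have h2 := (hs' p v).1 (hp.trans hlt)
    have h3 : ∀ u < v, s p ≤ u ↔ t p ≤ u := fun u hu => by rw [← hs', ← ht', heq u hu]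
    change s p = t p
    by_contra hne
    rcases Nat.lt_or_gt_of_ne hne with h | h
    · have := (h3 (s p) (by omega)).1 le_rfl
      omega
    · have := (h3 (t p) (by omega)).2 le_rfl
      omega
  · change s ⟨_, hn⟩ < t ⟨_, hn⟩
    have h1 := (hs' ⟨_, hn⟩ v).1 hlt
    have h2 := (ht' ⟨_, hn⟩ v).not.1 (lt_irrefl _)
    omega

/-- Moving one unit from an entry to one smaller by at least two improves the sorted tuple. -/
theorem toLex_sort_lt_of_transfer {x z : Fin n → ℕ} {i j : Fin n} (hij : x j + 2 ≤ x i)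
    (hz : ∀ k, z k + (if k = i then 1 else 0) = x k + if k = j then 1 else 0) :
    toLex (x ∘ Tuple.sort x) < toLex (z ∘ Tuple.sort z) := by
  refine toLex_lt_of_card_filter_le (Tuple.monotone_sort x) (Tuple.monotone_sort z) (x j)
    (fun u hu => ?_) ?_
  · simp only [card_filter_comp_perm_le]
    congr 1
    ext k
    have := hz k
    simp only [mem_filter, mem_univ, true_and]
    split_ifs at this <;> subst_vars <;> omega
  · simp only [card_filter_comp_perm_le]
    apply Finset.card_lt_card
    rw [Finset.ssubset_iff_of_subset]
    · refine ⟨j, by simp, ?_⟩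
      have := hz j
      simp only [mem_filter, mem_univ, true_and]
      split_ifs at this <;> subst_vars <;> omega
    · intro k
      have := hz k
      simp only [mem_filter, mem_univ, true_and]
      split_ifs at this <;> subst_vars <;> omega

/-- Moving one unit from an entry to one smaller by exactly one permutes the tuple. -/
theorem sort_eq_of_transfer {x z : Fin n → ℕ} {i j : Fin n} (hij : x i = x j + 1)
    (hz : ∀ k, z k + (if k = i then 1 else 0) = x k + if k = j then 1 else 0) :
    z ∘ Tuple.sort z = x ∘ Tuple.sort x := by
  obtain rfl : z = x ∘ Equiv.swap i j := by
    ext k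
    have := hz k
    simp only [Function.comp_apply, Equiv.swap_apply_def]
    split_ifs at this ⊢ <;> subst_vars <;> omega
  exact Tuple.comp_perm_comp_sort_eq_comp_sort

end SortedTuples

section LexiMin

variable {m n : ℕ} {M : Fin n → Matroid (Fin m)}

/-- Exchange towards a max-USW clean allocation from a LexiMin-optimal one: it either permutes
the profile, giving again a LexiMin-optimal allocation, or moves a unit to an agent with at least
as many items. -/
theorem LexiMinOpt.exists_exchange {χ ψ : Fin n → Finset (Fin m)} (hχ : LexiMinOpt M χ)
    (hψ : MaxUSWClean M ψ) {i : Fin n} (hi : (ψ i).card < (χ i).card) :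
    ∃ (ω : Fin n → Finset (Fin m)) (j : Fin n), (χ j).card < (ψ j).card ∧
      (∀ k, (ω k).card + (if k = i then 1 else 0) = (χ k).card + if k = j then 1 else 0) ∧
      (χ i).card ≤ (χ j).card + 1 ∧ ((χ i).card = (χ j).card + 1 → LexiMinOpt M ω) := by
  obtain ⟨ω, j, hω, hj, hc⟩ := hχ.1.exists_exchange hψ hi
  refine ⟨ω, j, hj, hc, ?_, fun h => ⟨hω, fun χ' h' => ?_⟩⟩
  · by_contra hlt
    exact (toLex_sort_lt_of_transfer (x := fun k => (χ k).card) (z := fun k => (ω k).card)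
      (i := i) (j := j) (by omega) hc).not_ge (hχ.2 ω hω)
  · have heq : sortedProfS ω = sortedProfS χ :=
      sort_eq_of_transfer (x := fun k => (χ k).card) (z := fun k => (ω k).card) h hc
    exact heq ▸ hχ.2 χ' h'

theorem LexiMinOpt.card_le_card_add_one {χ ψ : Fin n → Finset (Fin m)} (hχ : LexiMinOpt M χ)
    (hψ : LexiMinOpt M ψ) (i : Fin n) : (χ i).card ≤ (ψ i).card + 1 := by
  induction hd : ∑ k, Nat.dist (χ k).card (ψ k).card using Nat.strong_induction_on
    generalizing ψ with
  | _ d ih =>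
  by_contra hi
  obtain ⟨-, q, hq, -, hqi, -⟩ := hχ.exists_exchange hψ.1 (i := i) (by omega)
  obtain ⟨p, hp, hmax⟩ := Finset.exists_max_image
    ({k | (χ k).card < (ψ k).card} : Finset (Fin n)) (fun k => (ψ k).card) ⟨q, by simpa using hq⟩
  simp only [mem_filter, mem_univ, true_and] at hp hmax
  have hpq := hmax q hq
  obtain ⟨ω, l, hl, hc, hpl, hopt⟩ := hψ.exists_exchange hχ.1 hp
  by_cases heq : (ψ p).card = (ψ l).card + 1
  · have hli : i ≠ l := by rintro rfl; omega
    have hpi : i ≠ p := by rintro rfl; omega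
    have hci := hc i
    rw [if_neg hli, if_neg hpi, add_zero, add_zero] at hci
    refine hi (hci ▸ ih _ ?_ (hopt heq) rfl)
    rw [← hd]
    refine Finset.sum_lt_sum (fun k _ => ?_) ⟨p, mem_univ p, ?_⟩
    · have := hc k
      unfold Nat.dist
      split_ifs at this <;> subst_vars <;> omega
    · have := hc p
      unfold Nat.dist
      split_ifs at this <;> subst_vars <;> omega
  · obtain ⟨-, r, hr, -, hrl, -⟩ := hχ.exists_exchange hψ.1 hl
    have := hmax r hr
    omega

end LexiMin

/-- under binary submodular (matroid-rank) valuations, any two LexiMin-optimal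
max-USW clean allocations have profiles at Chebyshev distance at most `1`. -/
theorem matroid_leximin_chebyshev_le_one {m n : ℕ} (M : Fin n → Matroid (Fin m))
    (hE : ∀ i, (M i).E = Set.univ)
    (χ χ' : Fin n → Finset (Fin m)) (hχ : LexiMinOpt M χ) (hχ' : LexiMinOpt M χ') :
    ∀ i : Fin n, |((χ i).card : ℤ) - ((χ' i).card : ℤ)| ≤ 1 := by
  intro i
  have h1 := hχ.card_le_card_add_one hχ' i
  have h2 := hχ'.card_le_card_add_one hχ i
  rw [abs_le]
  omega
end

section
/- Let p : Fin n → ℝ with p_i > 0 for all i, let j ≠ k, and let Δ > 0 with p_j − p_k ≥ 2Δ. Define q by q_j = p_j − Δ, q_k = p_k + Δ, and q_i = p_i for i ∉ {j, k}. Then ∏_i q_i > ∏_i p_i. (Hence the negated Nash social welfare criterion NSW⁻(p) = −∏_i p_i strictly decreases under a Pigou–Dalton transfer on positive profiles.) -/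
open Finset

/-- a Pigou–Dalton transfer on a positive profile strictly increases the
product of the entries (hence strictly decreases `NSW⁻(p) = -∏ i, p i`). -/
theorem prod_lt_of_pigou_dalton {n : ℕ} (p q : Fin n → ℝ) (hp : ∀ i, 0 < p i)
    (j k : Fin n) (hjk : j ≠ k) (Δ : ℝ) (hΔ : 0 < Δ) (hgap : 2 * Δ ≤ p j - p k)
    (hqj : q j = p j - Δ) (hqk : q k = p k + Δ)
    (hq : ∀ i, i ≠ j → i ≠ k → q i = p i) :
    ∏ i, p i < ∏ i, q i := by
  have hk : k ∈ univ.erase j := mem_erase.2 ⟨hjk.symm, mem_univ k⟩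
  have split (f : Fin n → ℝ) : ∏ i, f i = f j * f k * ∏ i ∈ (univ.erase j).erase k, f i := by
    rw [← mul_prod_erase univ f (mem_univ j), ← mul_prod_erase _ f hk, mul_assoc]
  have hrest : ∏ i ∈ (univ.erase j).erase k, q i = ∏ i ∈ (univ.erase j).erase k, p i :=
    prod_congr rfl fun i hi =>
      hq i (ne_of_mem_erase (mem_of_mem_erase hi)) (ne_of_mem_erase hi)
  rw [split p, split q, hrest, hqj, hqk]
  refine mul_lt_mul_of_pos_right ?_ (prod_pos fun i _ => hp i)
  nlinarith [mul_pos hΔ (show 0 < p j - p k - Δ by linarith)]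
end

section
/- Let p : Fin n → ℝ, let j ≠ k, and let Δ > 0 with p_j − p_k ≥ 2Δ. Define q by q_j = p_j − Δ, q_k = p_k + Δ, and q_i = p_i for i ∉ {j, k}. Then EnvySum(q) < EnvySum(p), where EnvySum(h) = Σ over ordered pairs (i, j) with h_i < h_j of (h_j − h_i). (Hence the EnvySum criterion strictly decreases under a Pigou–Dalton transfer.) -/
open Finset

/-- `EnvySum h`: the sum, over ordered pairs `(i, j)` with `h i < h j`, of `h j - h i`. -/
noncomputable def EnvySum {n : ℕ} (h : Fin n → ℝ) : ℝ :=
  ∑ i, ∑ j, if h i < h j then h j - h i else 0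

lemma envySum_eq_sum_max {n : ℕ} (h : Fin n → ℝ) :
    EnvySum h = ∑ x : Fin n × Fin n, max (h x.2 - h x.1) 0 := by
  rw [EnvySum, Fintype.sum_prod_type]
  refine sum_congr rfl fun a _ => sum_congr rfl fun b _ => ?_
  split_ifs with hab
  · exact (max_eq_left (sub_nonneg.2 hab.le)).symm
  · exact (max_eq_right (sub_nonpos.2 (not_lt.1 hab))).symm

lemma envySum_comp_perm {n : ℕ} (h : Fin n → ℝ) (σ : Equiv.Perm (Fin n)) :
    EnvySum (h ∘ σ) = EnvySum h := by
  simp only [envySum_eq_sum_max]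
  exact (Equiv.prodCongr σ σ).sum_comp fun x => max (h x.2 - h x.1) 0

/-- `EnvySum` is convex, and strictly so between vectors that order some pair oppositely. -/
lemma envySum_convexCombo_lt {n : ℕ} {f g h : Fin n → ℝ} {t : ℝ} (ht₀ : 0 < t) (ht₁ : t < 1)
    (hh : ∀ i, h i = (1 - t) * f i + t * g i) {a b : Fin n} (hf : f a < f b) (hg : g b < g a) :
    EnvySum h < (1 - t) * EnvySum f + t * EnvySum g := by
  simp only [envySum_eq_sum_max, mul_sum, ← sum_add_distrib]
  refine sum_lt_sum (fun x _ => ?_) ⟨(a, b), mem_univ _, ?_⟩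
  · rw [hh, hh]
    apply max_le
    · linarith [mul_le_mul_of_nonneg_left (le_max_left (f x.2 - f x.1) 0) (sub_nonneg.2 ht₁.le),
        mul_le_mul_of_nonneg_left (le_max_left (g x.2 - g x.1) 0) ht₀.le]
    · have := sub_nonneg.2 ht₁.le
      positivity
  · rw [hh, hh, max_eq_left (sub_nonneg.2 hf.le), max_eq_right (sub_nonpos.2 hg.le)]
    have hfpos := mul_pos (sub_pos.2 ht₁) (sub_pos.2 hf)
    have hgpos := mul_pos ht₀ (sub_pos.2 hg)
    apply max_lt <;> linarith

/-- a Pigou–Dalton transfer strictly decreases `EnvySum`. -/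
theorem envySum_lt_of_pigou_dalton {n : ℕ} (p q : Fin n → ℝ)
    (j k : Fin n) (hjk : j ≠ k) (Δ : ℝ) (hΔ : 0 < Δ) (hgap : 2 * Δ ≤ p j - p k)
    (hqj : q j = p j - Δ) (hqk : q k = p k + Δ)
    (hq : ∀ i, i ≠ j → i ≠ k → q i = p i) :
    EnvySum q < EnvySum p := by
  have hD : 0 < p j - p k := by linarith
  have ht₀ : 0 < Δ / (p j - p k) := div_pos hΔ hD
  have ht₁ : Δ / (p j - p k) < 1 := (div_lt_one hD).2 (by linarith)
  have htD : Δ / (p j - p k) * (p j - p k) = Δ := div_mul_cancel₀ _ hD.ne'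
  have hcombo : ∀ i, q i = (1 - Δ / (p j - p k)) * p i
      + Δ / (p j - p k) * (p ∘ Equiv.swap j k) i := by
    intro i
    rw [Function.comp_apply]
    by_cases hij : i = j
    · rw [hij, Equiv.swap_apply_left, hqj]
      linarith
    by_cases hik : i = k
    · rw [hik, Equiv.swap_apply_right, hqk]
      linarith
    · rw [Equiv.swap_apply_of_ne_of_ne hij hik, hq i hij hik]
      ring
  have hlt := envySum_convexCombo_lt ht₀ ht₁ hcombo (a := k) (b := j) (by linarith)
    (by simpa using hD)
  rw [envySum_comp_perm] at hlt
  linarith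
end
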